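/- Let F : ℝ^d → ℂ and, for each ε ∈ (0,1), G_ε : ℝ^d → ℂ. Assume: (i) there exist (b_i) ∈ 𝕽, (ℓ_i) ∈ 𝕽, C > 0 and ε_0 ∈ (0,1) such that |F(ξ) − G_ε(ξ)| ≤ C·e^{N_{(ℓ_i)}(|ξ|) − N_{(b_i)}(1/ε)} for all ξ ∈ ℝ^d and all ε < ε_0; (ii) there exists (k_i) ∈ 𝕽 with b_i ≤ k_i for all i, such that for every (h_i) ∈ 𝕽 there is C' > 0 with |G_ε(ξ)| ≤ C'·e^{N_{(k_i)}(1/ε) − N_{(h_i)}(|ξ|)} for all ξ ∈ ℝ^d and all ε < ε_0. Then for every (λ_i) ∈ 𝕽, sup_{ξ∈ℝ^d} |F(ξ)|·e^{N_{(λ_i)}(|ξ|)} < ∞. -/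

import Mathlib

open scoped BigOperators

/-- `log₊ x = max (log x) 0`. -/
noncomputable def logPlus (x : ℝ) : ℝ := max (Real.log x) 0

/-- The associated function `M(ρ) = sup_p log₊ (ρ^p / M_p)`. -/
noncomputable def assocM (Mp : ℕ → ℝ) (ρ : ℝ) : ℝ :=
  ⨆ p : ℕ, logPlus (ρ ^ p / Mp p)

/-- `N_{(r_i)}(ρ) = sup_p log₊ (ρ^p / (M_p · Π_{i=1}^p r_i))`
(the sequence `(r_i)_{i≥1}` is indexed here by `ℕ`, `r 0 = r_1`, etc.). -/
noncomputable def assocN (Mp : ℕ → ℝ) (r : ℕ → ℝ) (ρ : ℝ) : ℝ :=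
  ⨆ p : ℕ, logPlus (ρ ^ p / (Mp p * ∏ i ∈ Finset.range p, r i))

/-- `(r_i) ∈ 𝕽`: positive, monotonically increasing, tending to infinity. -/
def InRcal (r : ℕ → ℝ) : Prop :=
  (∀ i, 0 < r i) ∧ Monotone r ∧ Filter.Tendsto r Filter.atTop Filter.atTop

/-- Condition (M.1): logarithmic convexity. -/
def CondM1 (Mp : ℕ → ℝ) : Prop :=
  ∀ p : ℕ, (Mp (p + 1)) ^ 2 ≤ Mp p * Mp (p + 2)

/-- Condition (M.2) with constants `c0, H`. -/
def CondM2 (Mp : ℕ → ℝ) (c0 H : ℝ) : Prop :=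
  ∀ p q : ℕ, Mp (p + q) ≤ c0 * H ^ (p + q) * Mp p * Mp q

/-- Condition (M.2). -/
def CondM2' (Mp : ℕ → ℝ) : Prop :=
  ∃ c0 H : ℝ, 1 ≤ c0 ∧ 1 ≤ H ∧ CondM2 Mp c0 H

/-- Condition (M.3): `Σ_{j=p+1}^∞ M_{j-1}/M_j ≤ c0 · p · M_p / M_{p+1}`. -/
def CondM3 (Mp : ℕ → ℝ) : Prop :=
  ∃ c0 : ℝ, 1 ≤ c0 ∧ ∀ p : ℕ, 1 ≤ p →
    ∑' n : ℕ, Mp (p + n) / Mp (p + n + 1) ≤ c0 * p * Mp p / Mp (p + 1)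

lemma logPlus_nonneg (x : ℝ) : 0 ≤ logPlus x := le_max_right _ _

lemma assocN_nonneg (Mp r : ℕ → ℝ) (ρ : ℝ) : 0 ≤ assocN Mp r ρ :=
  Real.iSup_nonneg fun _ => logPlus_nonneg _

lemma InRcal.prod_pos {r : ℕ → ℝ} (hr : InRcal r) (p : ℕ) :
    0 < ∏ i ∈ Finset.range p, r i :=
  Finset.prod_pos fun i _ => hr.1 i

lemma InRcal.denom_pos {Mp r : ℕ → ℝ} (hMpos : ∀ p, 0 < Mp p) (hr : InRcal r) (p : ℕ) :
    0 < Mp p * ∏ i ∈ Finset.range p, r i :=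
  mul_pos (hMpos p) (hr.prod_pos p)

/-- A real sequence that is eventually nonincreasing is bounded above. -/
lemma bddAbove_range_of_eventually_succ_le {a : ℕ → ℝ} {n₀ : ℕ}
    (h : ∀ n, n₀ ≤ n → a (n + 1) ≤ a n) : BddAbove (Set.range a) := by
  refine (((Set.finite_Iic n₀).image a).bddAbove.union
    (t := Set.range fun n => a (n₀ + n)) ⟨a n₀, ?_⟩).mono ?_
  · rintro _ ⟨n, rfl⟩
    induction n with
    | zero => exact le_rfl
    | succ n ih => exact (h (n₀ + n) (Nat.le_add_right _ _)).trans ih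
  · rintro _ ⟨n, rfl⟩
    rcases le_total n n₀ with hn | hn
    · exact Or.inl ⟨n, hn, rfl⟩
    · exact Or.inr ⟨n - n₀, by simp [Nat.add_sub_cancel' hn]⟩

/-- Logarithmic convexity makes the ratios `M_{p+1} / M_p` bounded below by `M_1 / M_0`. -/
lemma CondM1.le_ratio {Mp : ℕ → ℝ} (hMpos : ∀ p, 0 < Mp p) (hM1 : CondM1 Mp) (p : ℕ) :
    Mp 1 / Mp 0 ≤ Mp (p + 1) / Mp p := by
  induction p with
  | zero => exact le_rfl
  | succ p ih =>
    refine ih.trans ?_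
    rw [div_le_div_iff₀ (hMpos p) (hMpos (p + 1))]
    have := hM1 p
    nlinarith

/-- The supremum defining `assocN` is finite. -/
lemma assocN_bddAbove {Mp r : ℕ → ℝ} (hMpos : ∀ p, 0 < Mp p) (hM1 : CondM1 Mp)
    (hr : InRcal r) {ρ : ℝ} (hρ : 0 ≤ ρ) :
    BddAbove (Set.range fun p : ℕ => logPlus (ρ ^ p / (Mp p * ∏ i ∈ Finset.range p, r i))) := by
  set m := Mp 1 / Mp 0 with hm
  have hmpos : 0 < m := div_pos (hMpos 1) (hMpos 0)
  obtain ⟨n₀, hn₀⟩ := Filter.eventually_atTop.1 (hr.2.2.eventually_ge_atTop (ρ / m))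
  obtain ⟨A, hA⟩ := bddAbove_range_of_eventually_succ_le
    (a := fun p => ρ ^ p / (Mp p * ∏ i ∈ Finset.range p, r i)) (n₀ := n₀) (by
      intro n hn
      have h1 : ρ ≤ r n * m := (div_le_iff₀ hmpos).1 (hn₀ n hn)
      have h2 : m * Mp n ≤ Mp (n + 1) := (le_div_iff₀ (hMpos n)).1 (hM1.le_ratio hMpos n)
      have hd := hr.prod_pos n
      rw [div_le_div_iff₀ (hr.denom_pos hMpos _) (hr.denom_pos hMpos _), Finset.prod_range_succ,
        pow_succ]
      have h3 : ρ * Mp n ≤ Mp (n + 1) * r n := by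
        calc ρ * Mp n ≤ r n * m * Mp n := mul_le_mul_of_nonneg_right h1 (hMpos n).le
          _ = r n * (m * Mp n) := by ring
          _ ≤ r n * Mp (n + 1) := mul_le_mul_of_nonneg_left h2 (hr.1 n).le
          _ = _ := mul_comm _ _
      calc ρ ^ n * ρ * (Mp n * ∏ i ∈ Finset.range n, r i)
          = (ρ ^ n * ∏ i ∈ Finset.range n, r i) * (ρ * Mp n) := by ring
        _ ≤ (ρ ^ n * ∏ i ∈ Finset.range n, r i) * (Mp (n + 1) * r n) :=
            mul_le_mul_of_nonneg_left h3 (mul_nonneg (pow_nonneg hρ n) hd.le)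
        _ = _ := by ring)
  refine ⟨max A 0, ?_⟩
  rintro _ ⟨p, rfl⟩
  have h0 : 0 ≤ ρ ^ p / (Mp p * ∏ i ∈ Finset.range p, r i) :=
    div_nonneg (pow_nonneg hρ p) (hr.denom_pos hMpos p).le
  exact max_le_max ((Real.log_le_self h0).trans (hA ⟨p, rfl⟩)) le_rfl

lemma log_le_assocN {Mp r : ℕ → ℝ} (hMpos : ∀ p, 0 < Mp p) (hM1 : CondM1 Mp)
    (hr : InRcal r) {ρ : ℝ} (hρ : 0 ≤ ρ) (p : ℕ) :
    Real.log (ρ ^ p / (Mp p * ∏ i ∈ Finset.range p, r i)) ≤ assocN Mp r ρ :=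
  (le_max_left _ _).trans (le_ciSup (assocN_bddAbove hMpos hM1 hr hρ) p)

/-- Since the term of index `0` is `log 1`, positive parts may be dropped in `assocN`. -/
lemma assocN_le {Mp r : ℕ → ℝ} (hMpos : ∀ p, 0 < Mp p) (hM0 : Mp 0 = 1)
    (hr : InRcal r) {ρ A : ℝ} (hρ : 0 ≤ ρ)
    (h : ∀ p : ℕ, 0 < ρ ^ p / (Mp p * ∏ i ∈ Finset.range p, r i) →
      Real.log (ρ ^ p / (Mp p * ∏ i ∈ Finset.range p, r i)) ≤ A) :
    assocN Mp r ρ ≤ A := by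
  have hA : 0 ≤ A := by simpa [hM0] using h 0
  refine ciSup_le fun p => max_le ?_ hA
  rcases (div_nonneg (pow_nonneg hρ p) (hr.denom_pos hMpos p).le).eq_or_lt with h0 | h0
  · rw [← h0, Real.log_zero]
    exact hA
  · exact h p h0

/-- `assocN` is antitone in the sequence. -/
lemma assocN_anti {Mp r s : ℕ → ℝ} (hMpos : ∀ p, 0 < Mp p) (hM0 : Mp 0 = 1) (hM1 : CondM1 Mp)
    (hr : InRcal r) (hs : InRcal s) (hrs : ∀ i, r i ≤ s i) {ρ : ℝ} (hρ : 0 ≤ ρ) :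
    assocN Mp s ρ ≤ assocN Mp r ρ := by
  refine assocN_le hMpos hM0 hs hρ fun p hp => ?_
  refine (Real.log_le_log hp ?_).trans (log_le_assocN hMpos hM1 hr hρ p)
  exact div_le_div_of_nonneg_left (pow_nonneg hρ p) (hr.denom_pos hMpos p)
    (mul_le_mul_of_nonneg_left
      (Finset.prod_le_prod (fun i _ => (hr.1 i).le) fun i _ => hrs i) (hMpos p).le)

lemma prod_half_le_of_le {u : ℕ → ℝ} (hpos : ∀ i, 0 < u i) (hmono : Monotone u) {p q : ℕ}
    (hpq : p ≤ q) :
    ∏ i ∈ Finset.range (p + q), u (i / 2) ≤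
      (∏ i ∈ Finset.range p, u i) * ∏ i ∈ Finset.range q, u i := by
  induction q, hpq using Nat.le_induction with
  | base =>
    apply le_of_eq
    induction p with
    | zero => simp
    | succ p ih =>
      rw [show p + 1 + (p + 1) = p + p + 1 + 1 by ring, Finset.prod_range_succ,
        Finset.prod_range_succ, ih, Finset.prod_range_succ,
        show (p + p) / 2 = p by lia, show (p + p + 1) / 2 = p by lia]
      ring
  | succ q hpq ih =>
    rw [← add_assoc, Finset.prod_range_succ, Finset.prod_range_succ _ q, ← mul_assoc]
    exact mul_le_mul ih (hmono (by lia)) (hpos _).le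
      (mul_nonneg (Finset.prod_nonneg fun i _ => (hpos i).le)
        (Finset.prod_nonneg fun i _ => (hpos i).le))

lemma prod_half_le {u : ℕ → ℝ} (hpos : ∀ i, 0 < u i) (hmono : Monotone u) (p q : ℕ) :
    ∏ i ∈ Finset.range (p + q), u (i / 2) ≤
      (∏ i ∈ Finset.range p, u i) * ∏ i ∈ Finset.range q, u i := by
  rcases le_total p q with h | h
  · exact prod_half_le_of_le hpos hmono h
  · rw [add_comm, mul_comm]
    exact prod_half_le_of_le hpos hmono h

/-- Under (M.2), a sum of two associated functions is dominated by a single one. -/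
lemma exists_assocN_add_le {Mp : ℕ → ℝ} (hMpos : ∀ p, 0 < Mp p) (hM0 : Mp 0 = 1)
    (hM1 : CondM1 Mp) (hM2 : CondM2' Mp) {r s : ℕ → ℝ} (hr : InRcal r) (hs : InRcal s) :
    ∃ h : ℕ → ℝ, InRcal h ∧ ∃ A : ℝ, ∀ ρ : ℝ, 0 ≤ ρ →
      assocN Mp r ρ + assocN Mp s ρ ≤ assocN Mp h ρ + A := by
  obtain ⟨c, H, hc, hH, hM2⟩ := hM2
  have hc0 : 0 < c := by linarith
  have hH0 : 0 < H := by linarith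
  set u : ℕ → ℝ := fun i => min (r i) (s i) with hu
  have hupos : ∀ i, 0 < u i := fun i => lt_min (hr.1 i) (hs.1 i)
  have humono : Monotone u := hr.2.1.min hs.2.1
  have hutop : Filter.Tendsto u Filter.atTop Filter.atTop := by
    refine Filter.tendsto_atTop.2 fun a => ?_
    filter_upwards [hr.2.2.eventually_ge_atTop a, hs.2.2.eventually_ge_atTop a] with i h1 h2
    exact le_min h1 h2
  have hh : InRcal fun i => u (i / 2) / H :=
    ⟨fun i => div_pos (hupos _) hH0,
      fun i j hij => div_le_div_of_nonneg_right (humono (Nat.div_le_div_right hij)) hH0.le,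
      (hutop.comp (Nat.tendsto_div_const_atTop two_ne_zero)).atTop_div_const hH0⟩
  refine ⟨_, hh, Real.log c, fun ρ hρ => ?_⟩
  rw [← le_sub_iff_add_le]
  refine assocN_le hMpos hM0 hr hρ fun p hp => ?_
  rw [le_sub_comm]
  refine assocN_le hMpos hM0 hs hρ fun q hq => ?_
  rw [le_sub_iff_add_le', ← Real.log_mul hp.ne' hq.ne']
  have hpq := mul_pos hp hq
  have key : ρ ^ p / (Mp p * ∏ i ∈ Finset.range p, r i) *
      (ρ ^ q / (Mp q * ∏ i ∈ Finset.range q, s i)) ≤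
      ρ ^ (p + q) / (Mp (p + q) * ∏ i ∈ Finset.range (p + q), u (i / 2) / H) * c := by
    rw [div_mul_div_comm, ← pow_add, div_mul_eq_mul_div,
      div_le_div_iff₀ (mul_pos (hr.denom_pos hMpos p) (hs.denom_pos hMpos q))
        (hh.denom_pos hMpos _), mul_assoc]
    refine mul_le_mul_of_nonneg_left ?_ (pow_nonneg hρ _)
    have hprod : (∏ i ∈ Finset.range (p + q), u (i / 2)) ≤
        (∏ i ∈ Finset.range p, r i) * ∏ i ∈ Finset.range q, s i :=
      (prod_half_le hupos humono p q).trans <| mul_le_mul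
        (Finset.prod_le_prod (fun i _ => (hupos i).le) fun i _ => min_le_left _ _)
        (Finset.prod_le_prod (fun i _ => (hupos i).le) fun i _ => min_le_right _ _)
        (Finset.prod_nonneg fun i _ => (hupos i).le) (hr.prod_pos p).le
    calc Mp (p + q) * ∏ i ∈ Finset.range (p + q), u (i / 2) / H
        ≤ (c * H ^ (p + q) * Mp p * Mp q) * ∏ i ∈ Finset.range (p + q), u (i / 2) / H :=
          mul_le_mul_of_nonneg_right (hM2 p q) (hh.prod_pos _).le
      _ = (c * Mp p * Mp q) * ∏ i ∈ Finset.range (p + q), u (i / 2) := by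
          rw [Finset.prod_div_distrib, Finset.prod_const, Finset.card_range]
          field_simp
      _ ≤ (c * Mp p * Mp q) *
            ((∏ i ∈ Finset.range p, r i) * ∏ i ∈ Finset.range q, s i) :=
          mul_le_mul_of_nonneg_left hprod
            (mul_nonneg (mul_nonneg hc0.le (hMpos p).le) (hMpos q).le)
      _ = _ := by ring
  have hz := pos_of_mul_pos_left (hpq.trans_le key) hc0.le
  calc _ ≤ _ := Real.log_le_log hpq key
    _ = _ := Real.log_mul hz.ne' hc0.ne'
    _ ≤ _ := add_le_add_left (log_le_assocN hMpos hM1 hh hρ _) _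

/-- `t ↦ N_{(r_i)}(e^t)` is a supremum of affine functions, hence convex. -/
lemma convexOn_assocN_exp {Mp r : ℕ → ℝ} (hMpos : ∀ p, 0 < Mp p) (hM0 : Mp 0 = 1)
    (hM1 : CondM1 Mp) (hr : InRcal r) :
    ConvexOn ℝ Set.univ fun t : ℝ => assocN Mp r (Real.exp t) := by
  refine ⟨convex_univ, fun x _ y _ a b ha hb hab => ?_⟩
  have hlog : ∀ (t : ℝ) (p : ℕ),
      Real.log (Real.exp t ^ p / (Mp p * ∏ i ∈ Finset.range p, r i)) =
        p * t - Real.log (Mp p * ∏ i ∈ Finset.range p, r i) := fun t p => by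
    rw [Real.log_div (pow_ne_zero _ (Real.exp_ne_zero _)) (hr.denom_pos hMpos p).ne',
      Real.log_pow, Real.log_exp]
  refine assocN_le hMpos hM0 hr (Real.exp_pos _).le fun p _ => ?_
  have hx := log_le_assocN hMpos hM1 hr (Real.exp_pos x).le p
  have hy := log_le_assocN hMpos hM1 hr (Real.exp_pos y).le p
  rw [hlog] at hx hy ⊢
  simp only [smul_eq_mul]
  have e : (p : ℝ) * (a * x + b * y) - Real.log (Mp p * ∏ i ∈ Finset.range p, r i) =
      a * (p * x - Real.log (Mp p * ∏ i ∈ Finset.range p, r i)) +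
        b * (p * y - Real.log (Mp p * ∏ i ∈ Finset.range p, r i)) := by
    linear_combination (-Real.log (Mp p * ∏ i ∈ Finset.range p, r i)) * hab.symm
  rw [e]
  exact add_le_add (mul_le_mul_of_nonneg_left hx ha) (mul_le_mul_of_nonneg_left hy hb)

/-- Beyond `e^{t₀}`, the function `N_{(r_i)}` attains every value above `N_{(r_i)}(e^{t₀})`. -/
lemma exists_assocN_exp_eq {Mp r : ℕ → ℝ} (hMpos : ∀ p, 0 < Mp p) (hM0 : Mp 0 = 1)
    (hM1 : CondM1 Mp) (hr : InRcal r) {t₀ X : ℝ} (hX : assocN Mp r (Real.exp t₀) ≤ X) :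
    ∃ t, t₀ ≤ t ∧ assocN Mp r (Real.exp t) = X := by
  have hcont : Continuous fun t : ℝ => assocN Mp r (Real.exp t) :=
    continuousOn_univ.1 ((convexOn_assocN_exp hMpos hM0 hM1 hr).continuousOn isOpen_univ)
  have htop : Filter.Tendsto (fun t : ℝ => assocN Mp r (Real.exp t)) Filter.atTop Filter.atTop := by
    refine Filter.tendsto_atTop_mono (f := fun t => t - Real.log (Mp 1 * r 0)) (fun t => ?_)
      (Filter.tendsto_atTop_add_const_right _ _ Filter.tendsto_id)
    have h := log_le_assocN hMpos hM1 hr (Real.exp_pos t).le 1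
    rwa [Finset.prod_range_one, pow_one,
      Real.log_div (Real.exp_ne_zero _) (mul_pos (hMpos 1) (hr.1 0)).ne', Real.log_exp] at h
  obtain ⟨t₁, ht₁, hX₁⟩ :=
    ((Filter.eventually_ge_atTop t₀).and (htop.eventually_ge_atTop X)).exists
  obtain ⟨t, ht, hXt⟩ := intermediate_value_Icc ht₁ hcont.continuousOn ⟨hX, hX₁⟩
  exact ⟨t, ht.1, hXt⟩

theorem stmt12 {d : ℕ} (Mp : ℕ → ℝ) (hMpos : ∀ p, 0 < Mp p) (hM0 : Mp 0 = 1)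
    (hM1 : CondM1 Mp) (hM2 : CondM2' Mp) (hM3 : CondM3 Mp)
    (F : EuclideanSpace ℝ (Fin d) → ℂ) (G : ℝ → EuclideanSpace ℝ (Fin d) → ℂ)
    (b ell k : ℕ → ℝ) (hb : InRcal b) (hell : InRcal ell) (hk : InRcal k)
    (hbk : ∀ i, b i ≤ k i) (C ε₀ : ℝ) (hC : 0 < C) (hε₀ : ε₀ ∈ Set.Ioo (0 : ℝ) 1)
    (h1 : ∀ (ξ : EuclideanSpace ℝ (Fin d)), ∀ ε : ℝ, 0 < ε → ε < ε₀ →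
      ‖F ξ - G ε ξ‖ ≤ C * Real.exp (assocN Mp ell ‖ξ‖ - assocN Mp b (1 / ε)))
    (h2 : ∀ h : ℕ → ℝ, InRcal h → ∃ C' : ℝ, 0 < C' ∧
      ∀ (ξ : EuclideanSpace ℝ (Fin d)), ∀ ε : ℝ, 0 < ε → ε < ε₀ →
        ‖G ε ξ‖ ≤ C' * Real.exp (assocN Mp k (1 / ε) - assocN Mp h ‖ξ‖)) :
    ∀ lam : ℕ → ℝ, InRcal lam → ∃ B : ℝ,
      ∀ ξ : EuclideanSpace ℝ (Fin d), ‖F ξ‖ * Real.exp (assocN Mp lam ‖ξ‖) ≤ B := by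
  intro lam hlam
  obtain ⟨h', hh', A', hA'⟩ := exists_assocN_add_le hMpos hM0 hM1 hM2 hlam hlam
  obtain ⟨h, hh, A, hA⟩ := exists_assocN_add_le hMpos hM0 hM1 hM2 hell hh'
  obtain ⟨C', hC', hG⟩ := h2 h hh
  set t₀ : ℝ := 1 - Real.log ε₀ with ht₀
  set K := assocN Mp b (Real.exp t₀) with hK
  have hK0 : 0 ≤ K := assocN_nonneg _ _ _
  refine ⟨C + C' * Real.exp (K + A + A'), fun ξ => ?_⟩
  have hN1 := assocN_nonneg Mp ell ‖ξ‖
  have hN2 := assocN_nonneg Mp lam ‖ξ‖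
  obtain ⟨t, ht, hX⟩ := exists_assocN_exp_eq hMpos hM0 hM1 hb (t₀ := t₀)
    (X := assocN Mp ell ‖ξ‖ + assocN Mp lam ‖ξ‖ + K) (by linarith)
  have hε : Real.exp (-t) < ε₀ := by
    rw [← Real.lt_log_iff_exp_lt hε₀.1]
    linarith
  have hinv : 1 / Real.exp (-t) = Real.exp t := by rw [Real.exp_neg, one_div, inv_inv]
  have hF := h1 ξ _ (Real.exp_pos _) hε
  have hGξ := hG ξ _ (Real.exp_pos _) hε
  rw [hinv] at hF hGξ
  have hkb := assocN_anti hMpos hM0 hM1 hb hk hbk (Real.exp_pos t).le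
  have hAξ := hA ‖ξ‖ (norm_nonneg ξ)
  have hAξ' := hA' ‖ξ‖ (norm_nonneg ξ)
  have hsum : ‖F ξ‖ ≤ ‖F ξ - G (Real.exp (-t)) ξ‖ + ‖G (Real.exp (-t)) ξ‖ := by
    simpa using norm_add_le (F ξ - G (Real.exp (-t)) ξ) (G (Real.exp (-t)) ξ)
  have hexp := Real.exp_pos (assocN Mp lam ‖ξ‖)
  calc ‖F ξ‖ * Real.exp (assocN Mp lam ‖ξ‖)
      ≤ (C * Real.exp (assocN Mp ell ‖ξ‖ - assocN Mp b (Real.exp t)) +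
          C' * Real.exp (assocN Mp k (Real.exp t) - assocN Mp h ‖ξ‖)) *
          Real.exp (assocN Mp lam ‖ξ‖) :=
        mul_le_mul_of_nonneg_right (hsum.trans (add_le_add hF hGξ)) hexp.le
    _ = C * Real.exp (assocN Mp ell ‖ξ‖ - assocN Mp b (Real.exp t) + assocN Mp lam ‖ξ‖) +
          C' * Real.exp (assocN Mp k (Real.exp t) - assocN Mp h ‖ξ‖ + assocN Mp lam ‖ξ‖) := by
        rw [Real.exp_add _ (assocN Mp lam ‖ξ‖), Real.exp_add _ (assocN Mp lam ‖ξ‖)]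
        ring
    _ ≤ C * 1 + C' * Real.exp (K + A + A') := by
        refine add_le_add (mul_le_mul_of_nonneg_left (Real.exp_le_one_iff.2 ?_) hC.le)
          (mul_le_mul_of_nonneg_left (Real.exp_le_exp.2 ?_) hC'.le) <;> linarith
    _ = _ := by rw [mul_one]
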